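/- In the group G = (ℤ/3ℤ)² × (ℤ/5ℤ) of order 45, let H = {(0,0)} × (ℤ/5ℤ) be the subgroup of order 5. The three 5-element subsets B₁ = {(0,0,0),(0,1,0),(0,2,1),(1,0,2),(2,1,2)}, B₂ = {(0,0,0),(0,1,2),(1,0,1),(2,0,0),(2,2,2)}, and B₃ = H form a family such that the within-block differences of B₁ and B₂ cover every element of G \ H exactly once. Consequently the translates of B₁ and B₂ together with the 9 cosets of H form a Steiner system S(2,5,45) on the 45 points of G. -/

import Mathlib

/-- Number of ordered pairs of distinct elements of `B` whose difference is `g`. -/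
def dcount {G : Type*} [AddCommGroup G] [DecidableEq G] (B : Finset G) (g : G) : ℕ :=
  ((B ×ˢ B).filter (fun p => p.1 ≠ p.2 ∧ p.1 - p.2 = g)).card

def B8 : Fin 2 → Finset (ZMod 3 × ZMod 3 × ZMod 5) :=
  ![{(0,0,0),(0,1,0),(0,2,1),(1,0,2),(2,1,2)},
    {(0,0,0),(0,1,2),(1,0,1),(2,0,0),(2,2,2)}]

/-- The subgroup `{(0,0)} × ℤ/5ℤ` of order 5, as a finset. -/
def H8 : Finset (ZMod 3 × ZMod 3 × ZMod 5) :=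
  Finset.univ.filter (fun x => x.1 = 0 ∧ x.2.1 = 0)

section DifferenceFamily

variable {G : Type*} [AddCommGroup G] [DecidableEq G]

theorem dcount_pos_of_mem {B : Finset G} {a b : G} (ha : a ∈ B) (hb : b ∈ B) (hab : a ≠ b) :
    0 < dcount B (a - b) :=
  Finset.card_pos.2 ⟨(a, b), by simp [ha, hb, hab]⟩

theorem eq_of_dcount_le_one {B : Finset G} {g a b a' b' : G} (h : dcount B g ≤ 1) (hg : g ≠ 0)
    (ha : a ∈ B) (hb : b ∈ B) (hab : a - b = g)
    (ha' : a' ∈ B) (hb' : b' ∈ B) (hab' : a' - b' = g) : b = b' := by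
  have hne : ∀ {x y : G}, x - y = g → x ≠ y := fun hxy e => hg (by rw [← hxy, e, sub_self])
  have := Finset.card_le_one.1 h (a, b) (by simp [ha, hb, hab, hne hab]) (a', b')
    (by simp [ha', hb', hab', hne hab'])
  exact congrArg Prod.snd this

theorem mem_image_add_right_iff_sub_mem {B : Finset G} {g x : G} :
    x ∈ B.image (· + g) ↔ x - g ∈ B := by
  simp only [Finset.mem_image]
  exact ⟨by rintro ⟨a, ha, rfl⟩; simpa using ha, fun h => ⟨_, h, sub_add_cancel x g⟩⟩

/-- The translates of the blocks of a difference family relative to a subgroup, together with the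
cosets of the subgroup, cover every pair of distinct points exactly once. -/
theorem existsUnique_translate_mem {ι : Type*} [Fintype ι] (B : ι → Finset G)
    (H : Finset G) (K : AddSubgroup G) (hK : ∀ x, x ∈ H ↔ x ∈ K)
    (hout : ∀ g, g ∉ H → ∑ i, dcount (B i) g = 1)
    (hin : ∀ g, g ∈ H → ∑ i, dcount (B i) g = 0) (p q : G) (hpq : p ≠ q) :
    ∃! C : Finset G, ((∃ i, ∃ g, C = (B i).image (· + g)) ∨ ∃ g, C = H.image (· + g)) ∧
      p ∈ C ∧ q ∈ C := by
  classical
  have key : ∀ i g, p - g ∈ B i → q - g ∈ B i → 0 < dcount (B i) (p - q) := fun i g hp hq => by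
    simpa using dcount_pos_of_mem hp hq (by simpa using hpq)
  by_cases hH : p - q ∈ H
  · refine ⟨H.image (· + q), ⟨Or.inr ⟨q, rfl⟩, ?_, ?_⟩, ?_⟩
    · exact mem_image_add_right_iff_sub_mem.2 hH
    · exact mem_image_add_right_iff_sub_mem.2 (by simp [hK, K.zero_mem])
    · rintro C ⟨⟨i, g, rfl⟩ | ⟨g, rfl⟩, hp, hq⟩ <;>
        rw [mem_image_add_right_iff_sub_mem] at hp hq
      · have h0 := Finset.sum_eq_zero_iff.1 (hin _ hH) i (Finset.mem_univ i)
        exact absurd h0 (key i g hp hq).ne'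
      · ext x
        rw [mem_image_add_right_iff_sub_mem, mem_image_add_right_iff_sub_mem, hK, hK]
        rw [hK] at hq
        rw [← sub_add_sub_cancel x q g, K.add_mem_cancel_right hq]
  · have hsum := hout _ hH
    have hle : ∀ i, dcount (B i) (p - q) ≤ 1 := fun i =>
      hsum ▸ Finset.single_le_sum (f := fun i => dcount (B i) (p - q))
        (fun _ _ => Nat.zero_le _) (Finset.mem_univ i)
    obtain ⟨i, -, hi⟩ := Finset.exists_ne_zero_of_sum_ne_zero (hsum.trans_ne one_ne_zero)
    obtain ⟨⟨a, b⟩, hab⟩ := Finset.card_pos.1 (Nat.pos_of_ne_zero hi)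
    simp only [Finset.mem_filter, Finset.mem_product] at hab
    obtain ⟨⟨ha, hb⟩, -, hd⟩ := hab
    have hpa : p - (q - b) = a := by rw [sub_sub_eq_add_sub, add_sub_right_comm, ← hd]; abel
    refine ⟨(B i).image (· + (q - b)), ⟨Or.inl ⟨i, _, rfl⟩, ?_, ?_⟩, ?_⟩
    · rwa [mem_image_add_right_iff_sub_mem, hpa]
    · rwa [mem_image_add_right_iff_sub_mem, sub_sub_cancel]
    · rintro C ⟨⟨j, g, rfl⟩ | ⟨g, rfl⟩, hp, hq⟩ <;>
        rw [mem_image_add_right_iff_sub_mem] at hp hq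
      · obtain rfl : j = i := by
          by_contra hji
          have h2 := Finset.sum_le_sum_of_subset (f := fun i => dcount (B i) (p - q))
            (Finset.subset_univ {j, i})
          rw [Finset.sum_pair hji, hsum] at h2
          have h3 := key j g hp hq
          omega
        have hbg := eq_of_dcount_le_one (hle j) (sub_ne_zero.2 hpq) ha hb hd hp hq
          (sub_sub_sub_cancel_right p q g)
        rw [hbg, sub_sub_cancel]
      · rw [hK] at hp hq
        exact absurd ((hK _).2 (by simpa using K.sub_mem hp hq)) hH

end DifferenceFamily

/-- The subgroup `{(0,0)} × ℤ/5ℤ`. -/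
def subgroupH8 : AddSubgroup (ZMod 3 × ZMod 3 × ZMod 5) :=
  (⊥ : AddSubgroup (ZMod 3)).prod ((⊥ : AddSubgroup (ZMod 3)).prod ⊤)

theorem mem_H8_iff (x : ZMod 3 × ZMod 3 × ZMod 5) : x ∈ H8 ↔ x ∈ subgroupH8 := by
  simp [H8, subgroupH8, AddSubgroup.mem_prod]

theorem card_H8 : H8.card = 5 := by decide

theorem card_B8 : ∀ i, (B8 i).card = 5 := by decide

theorem sum_dcount_B8 : ∀ g, ∑ i, dcount (B8 i) g = if g ∈ H8 then 0 else 1 := by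
  decide +kernel

theorem stmt_8 :
    Fintype.card (ZMod 3 × ZMod 3 × ZMod 5) = 45 ∧
    H8.card = 5 ∧
    (∀ g : ZMod 3 × ZMod 3 × ZMod 5, g ∉ H8 → (∑ i : Fin 2, dcount (B8 i) g) = 1) ∧
    (∀ C : Finset (ZMod 3 × ZMod 3 × ZMod 5),
        ((∃ i : Fin 2, ∃ g : ZMod 3 × ZMod 3 × ZMod 5, C = (B8 i).image (· + g)) ∨
          (∃ g : ZMod 3 × ZMod 3 × ZMod 5, C = H8.image (· + g))) → C.card = 5) ∧
    (∀ p q : ZMod 3 × ZMod 3 × ZMod 5, p ≠ q →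
        ∃! C : Finset (ZMod 3 × ZMod 3 × ZMod 5),
          ((∃ i : Fin 2, ∃ g : ZMod 3 × ZMod 3 × ZMod 5, C = (B8 i).image (· + g)) ∨
            (∃ g : ZMod 3 × ZMod 3 × ZMod 5, C = H8.image (· + g))) ∧
            p ∈ C ∧ q ∈ C) := by
  have hout : ∀ g, g ∉ H8 → ∑ i, dcount (B8 i) g = 1 := fun g hg => by
    rw [sum_dcount_B8, if_neg hg]
  refine ⟨by simp, card_H8, hout, ?_, ?_⟩
  · rintro C (⟨i, g, rfl⟩ | ⟨g, rfl⟩)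
    · rw [Finset.card_image_of_injective _ (add_left_injective g), card_B8]
    · rw [Finset.card_image_of_injective _ (add_left_injective g), card_H8]
  · exact existsUnique_translate_mem B8 H8 subgroupH8 mem_H8_iff hout
      fun g hg => by rw [sum_dcount_B8, if_pos hg]
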